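/- For every tuple c = (c₁,…,c_n) of nonnegative integers and every word w ∈ W_c, one has fast(w) = ψ_c(s(φ^des_c(w))) and slow(w) = ψ_c(s(φ^asc_c(w))). -/

import Mathlib

lemma foldr_max_mem {w : List ℕ} (h : w ≠ []) : w.foldr max 0 ∈ w := by
  induction w with
  | nil => exact absurd rfl h
  | cons a l ih =>
    rcases eq_or_ne l [] with rfl | hl
    · simp
    · have hm := ih hl
      simp only [List.foldr_cons]
      rcases max_choice a (l.foldr max 0) with h' | h' <;> rw [h']
      · exact List.mem_cons_self
      · exact List.mem_cons_of_mem _ hm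

lemma headI_mem {α : Type*} [Inhabited α] {l : List α} (h : l ≠ []) : l.headI ∈ l := by
  cases l with
  | nil => exact absurd rfl h
  | cons a t => simp

/-- `blocks n w` is the list of maximal (possibly empty) blocks of `w`
separated by occurrences of the letter `n`; that is, if `n` occurs `k` times
in `w`, then `blocks n w = [A₁, A₂, …, A_{k+1}]` where `w = A₁ n A₂ n ⋯ n A_{k+1}`
and no `Aᵢ` contains the letter `n`. -/
def blocks (n : ℕ) : List ℕ → List (List ℕ)
  | [] => [[]]
  | a :: l =>
    if a = n then [] :: blocks n l
    else (a :: (blocks n l).headI) :: (blocks n l).tail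

lemma blocks_ne_nil (n : ℕ) (w : List ℕ) : blocks n w ≠ [] := by
  cases w with
  | nil => simp [blocks]
  | cons a l =>
    simp only [blocks]
    split <;> simp

lemma blocks_length {n : ℕ} {w : List ℕ} : ∀ {A : List ℕ}, A ∈ blocks n w →
    A.length + w.count n ≤ w.length := by
  induction w with
  | nil =>
    intro A hA
    simp only [blocks, List.mem_singleton] at hA
    subst hA; simp
  | cons a l ih =>
    intro A hA
    by_cases h : a = n
    · subst h
      simp only [blocks, if_pos rfl] at hA
      have hcc : (a :: l).count a = l.count a + 1 := by simp
      cases hA with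
      | head =>
        have := List.count_le_length (a := a) (l := l)
        simp only [List.length_nil, List.length_cons, hcc]
        omega
      | tail _ h1 =>
        have := ih h1
        simp only [List.length_cons, hcc]
        omega
    · simp only [blocks, if_neg h] at hA
      have hcc : (a :: l).count n = l.count n := by
        simp [List.count_cons, h]
      cases hA with
      | head =>
        have := ih (headI_mem (blocks_ne_nil n l))
        simp only [List.length_cons, hcc]
        omega
      | tail _ h1 =>
        have := ih (List.mem_of_mem_tail h1)
        simp only [List.length_cons, hcc]
        omega

/-- The generalized stack-sorting map `fast` (the convention in which a letter may
sit on top of a copy of itself in the stack): `fast ε = ε`, and if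
`w = A₁ n A₂ n ⋯ n A_{k+1}` where `n` is the largest letter of `w` (occurring
`k` times) and the `Aᵢ` contain only letters smaller than `n`, then
`fast w = fast A₁ ++ fast A₂ ++ ⋯ ++ fast A_{k+1} ++ n ⋯ n` (with `k` copies of `n`). -/
def fast (w : List ℕ) : List ℕ :=
  if h : w = [] then []
  else
    ((blocks (w.foldr max 0) w).attach.map
      fun (A : {x // x ∈ blocks (w.foldr max 0) w}) =>
      have : A.1.length < w.length := by
        have h1 := blocks_length A.2
        have h2 : 0 < w.count (w.foldr max 0) :=
          List.count_pos_iff.mpr (foldr_max_mem h)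
        omega
      fast A.1).flatten ++ List.replicate (w.count (w.foldr max 0)) (w.foldr max 0)
termination_by w.length

/-- The generalized stack-sorting map `slow` (the convention in which a letter may
not sit on top of a copy of itself in the stack): `slow ε = ε`, and if
`w = A₁ n A₂ n ⋯ n A_{k+1}` where `n` is the largest letter of `w` (occurring
`k` times) and the `Aᵢ` contain only letters smaller than `n`, then
`slow w = slow A₁ ++ slow A₂ ++ [n] ++ slow A₃ ++ [n] ++ ⋯ ++ slow A_{k+1} ++ [n]`. -/
def slow (w : List ℕ) : List ℕ :=
  if h : w = [] then []
  else
    (have : (blocks (w.foldr max 0) w).headI.length < w.length := by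
      have h1 := blocks_length (headI_mem (blocks_ne_nil (w.foldr max 0) w))
      have h2 : 0 < w.count (w.foldr max 0) :=
        List.count_pos_iff.mpr (foldr_max_mem h)
      omega
     slow (blocks (w.foldr max 0) w).headI) ++
    ((blocks (w.foldr max 0) w).tail.attach.map
      fun (A : {x // x ∈ (blocks (w.foldr max 0) w).tail}) =>
      have : A.1.length < w.length := by
        have h1 := blocks_length (List.mem_of_mem_tail A.2)
        have h2 : 0 < w.count (w.foldr max 0) :=
          List.count_pos_iff.mpr (foldr_max_mem h)
        omega
      slow A.1 ++ [w.foldr max 0]).flatten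
termination_by w.length

/-- Membership in `W_c`: `w` is a word over the positive integers with exactly
`cᵢ` copies of the letter `i` for each `1 ≤ i ≤ n = c.length` (and no other letters). -/
def InW (c : List ℕ) (w : List ℕ) : Prop :=
  0 ∉ w ∧ ∀ i : ℕ, w.count (i + 1) = c.getD i 0

/-- The identity word `Id_c = 1^{c₁} 2^{c₂} ⋯ n^{c_n}`, the unique word in `W_c`
whose letters are nondecreasing from left to right. -/
def idWord (c : List ℕ) : List ℕ :=
  ((List.range c.length).map fun i => List.replicate (c.getD i 0) (i + 1)).flatten

/-- West's stack-sorting map `s`, defined recursively by `s ε = ε` and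
`s (L n R) = s L ++ s R ++ [n]`, where `n` is the largest entry of the
permutation and `L`, `R` are the substrings to its left and right. -/
def westS (w : List ℕ) : List ℕ :=
  if h : w = [] then []
  else
    have hi : w.idxOf (w.foldr max 0) < w.length :=
      List.idxOf_lt_length_iff.mpr (foldr_max_mem h)
    westS (w.take (w.idxOf (w.foldr max 0))) ++
      westS (w.drop (w.idxOf (w.foldr max 0) + 1)) ++ [w.foldr max 0]
termination_by w.length
decreasing_by
  · simp only [List.length_take, List.foldr_attach]; omega
  · simp only [List.length_drop]; omega

/-- The letter-replacement map underlying `ψ_c`: the value `v` (with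
`p_i + 1 ≤ v ≤ p_i + c_i`, where `p_i = c₁ + ⋯ + c_{i-1}`) is sent to the letter `i`. -/
def psiLetter : List ℕ → ℕ → ℕ
  | [], _ => 0
  | a :: rest, v => if v ≤ a then 1 else psiLetter rest (v - a) + 1

/-- `ψ_c : S_{c₁+⋯+c_n} → W_c` replaces each of the entries `p_i+1, …, p_i+c_i`
by the letter `i`, where `p_i = c₁ + ⋯ + c_{i-1}`. -/
def psiMap (c : List ℕ) (π : List ℕ) : List ℕ := π.map (psiLetter c)

/-- `φ^asc_c : W_c → S_{c₁+⋯+c_n}` replaces the `cᵢ` copies of the letter `i`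
(from left to right) by the integers `p_i+1, p_i+2, …, p_i+c_i` in ascending order,
where `p_i = c₁ + ⋯ + c_{i-1}`. -/
def phiAsc (c : List ℕ) (w : List ℕ) : List ℕ :=
  (List.range w.length).map fun t =>
    (c.take (w.getD t 0 - 1)).sum + (w.take (t + 1)).count (w.getD t 0)

/-- `φ^des_c : W_c → S_{c₁+⋯+c_n}` replaces the `cᵢ` copies of the letter `i`
(from left to right) by the integers `p_i+1, p_i+2, …, p_i+c_i` in descending order,
where `p_i = c₁ + ⋯ + c_{i-1}`. -/
def phiDes (c : List ℕ) (w : List ℕ) : List ℕ :=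
  (List.range w.length).map fun t =>
    (c.take (w.getD t 0)).sum + 1 - (w.take (t + 1)).count (w.getD t 0)

lemma le_foldr_max {w : List ℕ} {a : ℕ} (h : a ∈ w) : a ≤ w.foldr max 0 := by
  induction w with
  | nil => simp at h
  | cons b l ih =>
    rw [List.foldr_cons]
    rcases List.mem_cons.mp h with rfl | h
    · exact le_max_left _ _
    · exact (ih h).trans (le_max_right _ _)

lemma foldr_max_eq {w : List ℕ} {n : ℕ} (hn : n ∈ w) (h : ∀ a ∈ w, a ≤ n) :
    w.foldr max 0 = n :=
  le_antisymm (h _ (foldr_max_mem (List.ne_nil_of_mem hn))) (le_foldr_max hn)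

lemma blocks_of_notMem {n : ℕ} {w : List ℕ} (h : n ∉ w) : blocks n w = [w] := by
  induction w with
  | nil => rfl
  | cons a l ih =>
    simp only [List.mem_cons, not_or] at h
    simp [blocks, ih h.2, Ne.symm h.1]

lemma blocks_append_cons (n : ℕ) (L R : List ℕ) :
    blocks n (L ++ n :: R) = blocks n L ++ blocks n R := by
  induction L with
  | nil => simp [blocks]
  | cons a l ih =>
    obtain ⟨b, t, hbt⟩ := List.exists_cons_of_ne_nil (blocks_ne_nil n l)
    rw [List.cons_append, blocks, blocks, ih, hbt]
    split <;> simp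

lemma fast_eq_blocks {n : ℕ} {w : List ℕ} (h : ∀ a ∈ w, a ≤ n) :
    fast w = ((blocks n w).map fast).flatten ++ List.replicate (w.count n) n := by
  by_cases hn : n ∈ w
  · conv_lhs => rw [fast]
    rw [dif_neg (List.ne_nil_of_mem hn)]
    simp only [foldr_max_eq hn h, List.map_attach_eq_pmap, List.pmap_eq_map]
  · simp [blocks_of_notMem hn, List.count_eq_zero_of_not_mem hn]

lemma slow_eq_blocks {n : ℕ} {w : List ℕ} (h : ∀ a ∈ w, a ≤ n) :
    slow w = slow (blocks n w).headI ++
      ((blocks n w).tail.map fun A => slow A ++ [n]).flatten := by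
  by_cases hn : n ∈ w
  · conv_lhs => rw [slow]
    rw [dif_neg (List.ne_nil_of_mem hn)]
    simp only [foldr_max_eq hn h, List.map_attach_eq_pmap, List.pmap_eq_map]
  · simp [blocks_of_notMem hn]

lemma fast_append_cons {n : ℕ} {L R : List ℕ} (hL : ∀ a ∈ L, a < n) (hR : ∀ a ∈ R, a ≤ n) :
    fast (L ++ n :: R) = fast L ++ fast R ++ [n] := by
  have hn : n ∉ L := fun h => (hL n h).false
  have hw : ∀ a ∈ L ++ n :: R, a ≤ n := by
    simp only [List.mem_append, List.mem_cons]
    rintro a (h | rfl | h)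
    exacts [(hL a h).le, le_rfl, hR a h]
  rw [fast_eq_blocks hw, fast_eq_blocks hR, blocks_append_cons, blocks_of_notMem hn]
  simp [List.count_eq_zero_of_not_mem hn, List.replicate_succ']

lemma slow_append_cons {n : ℕ} {L R : List ℕ} (hL : ∀ a ∈ L, a ≤ n) (hR : ∀ a ∈ R, a < n) :
    slow (L ++ n :: R) = slow L ++ slow R ++ [n] := by
  have hn : n ∉ R := fun h => (hR n h).false
  have hw : ∀ a ∈ L ++ n :: R, a ≤ n := by
    simp only [List.mem_append, List.mem_cons]
    rintro a (h | rfl | h)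
    exacts [hL a h, le_rfl, (hR a h).le]
  rw [slow_eq_blocks hw, slow_eq_blocks hL, blocks_append_cons, blocks_of_notMem hn]
  obtain ⟨b, t, hbt⟩ := List.exists_cons_of_ne_nil (blocks_ne_nil n L)
  simp [hbt]

lemma exists_westS_eq {π : List ℕ} (h : π ≠ []) : ∃ L m R, π = L ++ m :: R ∧
    (∀ a ∈ L, a ≤ m) ∧ (∀ a ∈ R, a ≤ m) ∧ westS π = westS L ++ westS R ++ [m] := by
  have hi := List.idxOf_lt_length_iff.mpr (foldr_max_mem h)
  refine ⟨π.take (π.idxOf (π.foldr max 0)), π.foldr max 0,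
    π.drop (π.idxOf (π.foldr max 0) + 1), ?_, fun a ha => le_foldr_max (List.mem_of_mem_take ha),
    fun a ha => le_foldr_max (List.mem_of_mem_drop ha), ?_⟩
  · conv_lhs => rw [← List.take_append_drop (π.idxOf (π.foldr max 0)) π,
      List.drop_eq_getElem_cons hi, List.getElem_idxOf hi]
  · conv_lhs => rw [westS]
    rw [dif_neg h]

lemma fast_map_eq {g : ℕ → ℕ} (hg : Monotone g) (π : List ℕ)
    (hπ : π.Pairwise fun x y => g x = g y → y < x) :
    fast (π.map g) = (westS π).map g := by
  induction hk : π.length using Nat.strong_induction_on generalizing π with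
  | _ k ih =>
  subst hk
  by_cases h : π = []
  · subst h; simp [fast, westS]
  obtain ⟨L, m, R, rfl, hL, hR, hs⟩ := exists_westS_eq h
  rw [hs]
  obtain ⟨pL, pR, hLR⟩ := List.pairwise_append.mp hπ
  have hlt : ∀ a ∈ L.map g, a < g m := by
    simp only [List.mem_map]
    rintro _ ⟨a, ha, rfl⟩
    exact (hg (hL a ha)).lt_of_ne fun e =>
      absurd (hLR a ha m List.mem_cons_self e) (hL a ha).not_gt
  have hle : ∀ a ∈ R.map g, a ≤ g m := by
    simp only [List.mem_map]
    rintro _ ⟨a, ha, rfl⟩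
    exact hg (hR a ha)
  rw [List.map_append, List.map_cons, fast_append_cons hlt hle,
    ih L.length (by simp) L pL rfl, ih R.length (by simp; omega) R pR.of_cons rfl]
  simp

lemma slow_map_eq {g : ℕ → ℕ} (hg : Monotone g) (π : List ℕ)
    (hπ : π.Pairwise fun x y => g x = g y → x < y) :
    slow (π.map g) = (westS π).map g := by
  induction hk : π.length using Nat.strong_induction_on generalizing π with
  | _ k ih =>
  subst hk
  by_cases h : π = []
  · subst h; simp [slow, westS]
  obtain ⟨L, m, R, rfl, hL, hR, hs⟩ := exists_westS_eq h
  rw [hs]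
  obtain ⟨pL, pR, -⟩ := List.pairwise_append.mp hπ
  obtain ⟨hmR, pR⟩ := List.pairwise_cons.mp pR
  have hle : ∀ a ∈ L.map g, a ≤ g m := by
    simp only [List.mem_map]
    rintro _ ⟨a, ha, rfl⟩
    exact hg (hL a ha)
  have hlt : ∀ a ∈ R.map g, a < g m := by
    simp only [List.mem_map]
    rintro _ ⟨a, ha, rfl⟩
    exact (hg (hR a ha)).lt_of_ne fun e => absurd (hmR a ha e.symm) (hR a ha).not_gt
  rw [List.map_append, List.map_cons, slow_append_cons hle hlt,
    ih L.length (by simp) L pL rfl, ih R.length (by simp; omega) R pR rfl]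
  simp

lemma monotone_psiLetter (c : List ℕ) : Monotone (psiLetter c) := by
  induction c with
  | nil => exact fun _ _ _ => le_rfl
  | cons a l ih =>
    intro x y hxy
    have := ih (Nat.sub_le_sub_right hxy a)
    simp only [psiLetter]
    split_ifs <;> omega

lemma psiLetter_eq {c : List ℕ} {i v : ℕ} (h₁ : (c.take i).sum < v)
    (h₂ : v ≤ (c.take (i + 1)).sum) : psiLetter c v = i + 1 := by
  induction c generalizing i v with
  | nil => simp at h₁ h₂; omega
  | cons a l ih =>
    rw [List.take_succ_cons, List.sum_cons] at h₂
    cases i with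
    | zero => simp [psiLetter] at h₂ ⊢; omega
    | succ i =>
      rw [List.take_succ_cons, List.sum_cons] at h₁
      rw [psiLetter, if_neg (by omega), ih (i := i) (by omega) (by omega)]

lemma count_take_lt_count_take {w : List ℕ} {t u : ℕ} (htu : t < u) (hu : u < w.length) :
    (w.take (t + 1)).count w[u] < (w.take (u + 1)).count w[u] := by
  rw [List.take_succ_eq_append_getElem hu, List.count_append]
  have := (List.take_sublist_take_left (l := w) (show t + 1 ≤ u from htu)).count_le w[u]
  simp only [List.count_singleton_self]
  omega

/-- In a word of `W_c`, the copy of a letter `i + 1` at position `t` has rank between `1` and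
`c_{i+1}` among the copies of that letter. -/
lemma InW.exists_letter_rank {c w : List ℕ} (hw : InW c w) {t : ℕ} (ht : t < w.length) :
    ∃ i, w[t] = i + 1 ∧ 0 < (w.take (t + 1)).count w[t] ∧
      (c.take i).sum + (w.take (t + 1)).count w[t] ≤ (c.take (i + 1)).sum := by
  have h₀ : w[t] ≠ 0 := fun h => hw.1 (h ▸ List.getElem_mem ht)
  obtain ⟨i, hi⟩ := Nat.exists_eq_succ_of_ne_zero h₀
  have hpos : 0 < (w.take (t + 1)).count w[t] := by
    rw [List.take_succ_eq_append_getElem ht, List.count_append, List.count_singleton_self]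
    omega
  have hle : (w.take (t + 1)).count w[t] ≤ c.getD i 0 := by
    rw [← hw.2 i, hi]
    exact (List.take_sublist _ _).count_le _
  refine ⟨i, hi, hpos, ?_⟩
  have hic : i < c.length := by
    by_contra hic
    rw [List.getD_eq_default _ _ (not_lt.mp hic)] at hle
    omega
  rw [List.getD_eq_getElem _ _ hic] at hle
  rw [List.sum_take_succ _ _ hic]
  omega

lemma psiLetter_phiAsc_getElem {c w : List ℕ} (hw : InW c w) {t : ℕ} (ht : t < w.length)
    (ht' : t < (phiAsc c w).length) : psiLetter c (phiAsc c w)[t] = w[t] := by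
  obtain ⟨i, hi, hpos, hle⟩ := hw.exists_letter_rank ht
  simp only [phiAsc, List.getElem_map, List.getElem_range, List.getD_eq_getElem _ _ ht]
  rw [hi] at hpos hle ⊢
  rw [Nat.add_sub_cancel]
  exact psiLetter_eq (by omega) hle

lemma psiLetter_phiDes_getElem {c w : List ℕ} (hw : InW c w) {t : ℕ} (ht : t < w.length)
    (ht' : t < (phiDes c w).length) : psiLetter c (phiDes c w)[t] = w[t] := by
  obtain ⟨i, hi, hpos, hle⟩ := hw.exists_letter_rank ht
  simp only [phiDes, List.getElem_map, List.getElem_range, List.getD_eq_getElem _ _ ht]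
  rw [hi] at hpos hle ⊢
  exact psiLetter_eq (by omega) (by omega)

lemma psiMap_phiAsc {c w : List ℕ} (hw : InW c w) : psiMap c (phiAsc c w) = w :=
  List.ext_getElem (by simp [psiMap, phiAsc]) fun t _ ht => by
    simp only [psiMap, List.getElem_map, psiLetter_phiAsc_getElem hw ht]

lemma psiMap_phiDes {c w : List ℕ} (hw : InW c w) : psiMap c (phiDes c w) = w :=
  List.ext_getElem (by simp [psiMap, phiDes]) fun t _ ht => by
    simp only [psiMap, List.getElem_map, psiLetter_phiDes_getElem hw ht]

lemma pairwise_phiAsc {c w : List ℕ} (hw : InW c w) :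
    (phiAsc c w).Pairwise fun x y => psiLetter c x = psiLetter c y → x < y := by
  refine List.pairwise_iff_getElem.mpr fun t u ht hu htu e => ?_
  have ht' : t < w.length := by simpa [phiAsc] using ht
  have hu' : u < w.length := by simpa [phiAsc] using hu
  rw [psiLetter_phiAsc_getElem hw ht', psiLetter_phiAsc_getElem hw hu'] at e
  have := count_take_lt_count_take htu hu'
  simp only [phiAsc, List.getElem_map, List.getElem_range, List.getD_eq_getElem _ _ ht',
    List.getD_eq_getElem _ _ hu', e]
  omega

lemma pairwise_phiDes {c w : List ℕ} (hw : InW c w) :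
    (phiDes c w).Pairwise fun x y => psiLetter c x = psiLetter c y → y < x := by
  refine List.pairwise_iff_getElem.mpr fun t u ht hu htu e => ?_
  have ht' : t < w.length := by simpa [phiDes] using ht
  have hu' : u < w.length := by simpa [phiDes] using hu
  rw [psiLetter_phiDes_getElem hw ht', psiLetter_phiDes_getElem hw hu'] at e
  have := count_take_lt_count_take htu hu'
  obtain ⟨i, hi, -, hle⟩ := hw.exists_letter_rank hu'
  simp only [phiDes, List.getElem_map, List.getElem_range, List.getD_eq_getElem _ _ ht',
    List.getD_eq_getElem _ _ hu', e]
  rw [hi] at this hle ⊢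
  omega

/-- For every tuple `c = (c₁, …, c_n)` of nonnegative integers and every word
`w ∈ W_c`, one has `fast w = ψ_c (s (φ^des_c w))` and `slow w = ψ_c (s (φ^asc_c w))`. -/
theorem fast_slow_eq_psi_s_phi (c : List ℕ) (w : List ℕ) (hw : InW c w) :
    fast w = psiMap c (westS (phiDes c w)) ∧
    slow w = psiMap c (westS (phiAsc c w)) := by
  have hdes := fast_map_eq (monotone_psiLetter c) _ (pairwise_phiDes hw)
  have hasc := slow_map_eq (monotone_psiLetter c) _ (pairwise_phiAsc hw)
  rw [← psiMap, ← psiMap] at hdes hasc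
  rw [psiMap_phiDes hw] at hdes
  rw [psiMap_phiAsc hw] at hasc
  exact ⟨hdes, hasc⟩
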